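/- The logic HLC♯ = HLC♭⊕di is sound and complete with respect to the class of flat frames (W, ≼, R) in which R[w] is a cluster for every w ∈ W (i.e. v ≼ u and u ≼ v for all v, u ∈ R[w], and R[w] is nonempty or empty as a ≼-cluster): Γ ⊢_{di} φ if and only if every flat frame in this class validates the consecution Γ ⇒ φ. -/

import Mathlib

/-- Formulas of the language `L⇛`. -/
inductive Fml : Type where
  | var : Nat → Fml
  | top : Fml
  | bot : Fml
  | and : Fml → Fml → Fml
  | or  : Fml → Fml → Fml
  | imp : Fml → Fml → Fml
  | sto : Fml → Fml → Fml
deriving DecidableEq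

/-- Uniform substitution. -/
def Fml.subst (σ : Nat → Fml) : Fml → Fml
  | .var p => σ p
  | .top => .top
  | .bot => .bot
  | .and φ ψ => .and (φ.subst σ) (ψ.subst σ)
  | .or φ ψ => .or (φ.subst σ) (ψ.subst σ)
  | .imp φ ψ => .imp (φ.subst σ) (ψ.subst σ)
  | .sto φ ψ => .sto (φ.subst σ) (ψ.subst σ)

/-- Conjunction `φ₁ ∧ ⋯ ∧ φₙ` of a list of formulas (`⊤` for the empty list). -/
def Fml.conj : List Fml → Fml
  | [] => .top
  | [φ] => φ
  | φ :: ψ :: rest => .and φ (Fml.conj (ψ :: rest))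

/-- Disjunction `φ₁ ∨ ⋯ ∨ φₙ` of a list of formulas (`⊥` for the empty list). -/
def Fml.disj : List Fml → Fml
  | [] => .bot
  | [φ] => φ
  | φ :: ψ :: rest => .or φ (Fml.disj (ψ :: rest))

/-- Axiom schemes of intuitionistic propositional logic (a standard Hilbert-style
axiomatisation); as schemes, they comprise all substitution instances. -/
inductive IpcAx : Fml → Prop where
  | k (φ ψ : Fml) : IpcAx (.imp φ (.imp ψ φ))
  | s (φ ψ χ : Fml) : IpcAx (.imp (.imp φ (.imp ψ χ)) (.imp (.imp φ ψ) (.imp φ χ)))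
  | andE1 (φ ψ : Fml) : IpcAx (.imp (.and φ ψ) φ)
  | andE2 (φ ψ : Fml) : IpcAx (.imp (.and φ ψ) ψ)
  | andI (φ ψ : Fml) : IpcAx (.imp φ (.imp ψ (.and φ ψ)))
  | orI1 (φ ψ : Fml) : IpcAx (.imp φ (.or φ ψ))
  | orI2 (φ ψ : Fml) : IpcAx (.imp ψ (.or φ ψ))
  | orE (φ ψ χ : Fml) : IpcAx (.imp (.imp φ χ) (.imp (.imp ψ χ) (.imp (.or φ ψ) χ)))
  | botE (φ : Fml) : IpcAx (.imp .bot φ)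
  | top : IpcAx .top

/-- Substitution instances of the axioms of intuitionistic logic together with
`k_a : ((p⇛q)∧(p⇛r))→(p⇛(q∧r))` and `tr : ((p⇛q)∧(q⇛r))→(p⇛r)`. -/
inductive BaseAx : Fml → Prop where
  | ipc {φ : Fml} : IpcAx φ → BaseAx φ
  | ka (φ ψ χ : Fml) : BaseAx (.imp (.and (.sto φ ψ) (.sto φ χ)) (.sto φ (.and ψ χ)))
  | tr (φ ψ χ : Fml) : BaseAx (.imp (.and (.sto φ ψ) (.sto ψ χ)) (.sto φ χ))

/-- Derivability of the consecution `Γ ⇒ φ` in `HLC♭ ⊕ Ax`, i.e. `Γ ⊢_Ax φ`. -/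
inductive Deriv (Ax : Set Fml) : Set Fml → Fml → Prop where
  | base {Γ : Set Fml} {φ : Fml} : BaseAx φ → Deriv Ax Γ φ
  | axm {Γ : Set Fml} {ψ : Fml} (σ : Nat → Fml) : ψ ∈ Ax → Deriv Ax Γ (ψ.subst σ)
  | el {Γ : Set Fml} {φ : Fml} : φ ∈ Γ → Deriv Ax Γ φ
  | mp {Γ : Set Fml} {φ ψ : Fml} : Deriv Ax Γ φ → Deriv Ax Γ (.imp φ ψ) → Deriv Ax Γ ψ
  | na {Γ : Set Fml} {φ ψ : Fml} : Deriv Ax (∅ : Set Fml) (.imp φ ψ) → Deriv Ax Γ (.sto φ ψ)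

/-- A flat frame: a nonempty set of worlds with a preorder `≼` and a relation `R`. -/
structure FlatFrame : Type 1 where
  W : Type
  ne : Nonempty W
  le : W → W → Prop
  le_refl : ∀ w, le w w
  le_trans : ∀ ⦃w v u⦄, le w v → le v u → le w u
  R : W → W → Prop

/-- A valuation is admissible if every proposition letter denotes an upset. -/
def FlatFrame.IsUpset (F : FlatFrame) (V : Nat → F.W → Prop) : Prop :=
  ∀ p ⦃w v⦄, F.le w v → V p w → V p v

/-- Truth of a formula at a world of a flat model: the usual intuitionistic Kripke
clauses over `≼`, and `w ⊨ φ⇛ψ` iff for every `w' ≽ w`, `R[w'] ⊆ ⟦φ⟧` implies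
`R[w'] ⊆ ⟦ψ⟧`. -/
def FlatFrame.sat (F : FlatFrame) (V : Nat → F.W → Prop) : Fml → F.W → Prop
  | .var p, w => V p w
  | .top, _ => True
  | .bot, _ => False
  | .and φ ψ, w => F.sat V φ w ∧ F.sat V ψ w
  | .or φ ψ, w => F.sat V φ w ∨ F.sat V ψ w
  | .imp φ ψ, w => ∀ v, F.le w v → F.sat V φ v → F.sat V ψ v
  | .sto φ ψ, w => ∀ w', F.le w w' →
      (∀ v, F.R w' v → F.sat V φ v) → ∀ v, F.R w' v → F.sat V ψ v

/-- A flat frame validates the consecution `Γ ⇒ φ` if in every model on it, every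
world satisfying all formulas of `Γ` satisfies `φ`. -/
def FlatFrame.ValidCons (F : FlatFrame) (Γ : Set Fml) (φ : Fml) : Prop :=
  ∀ V, F.IsUpset V → ∀ w, (∀ ψ ∈ Γ, F.sat V ψ w) → F.sat V φ w

/-- A flat frame validates a formula if it is true at every world in every model on it. -/
def FlatFrame.ValidFml (F : FlatFrame) (φ : Fml) : Prop :=
  ∀ V, F.IsUpset V → ∀ w, F.sat V φ w

/-- `em := p ∨ ¬p` (where `¬φ` abbreviates `φ→⊥`). -/
def emFml : Fml := .or (.var 0) (.imp (.var 0) .bot)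
/-- `t□ := (⊤⇛p)→p`. -/
def tbFml : Fml := .imp (.sto .top (.var 0)) (.var 0)
/-- `str := (p→q)→(p⇛q)`. -/
def strFml : Fml := .imp (.imp (.var 0) (.var 1)) (.sto (.var 0) (.var 1))
/-- `p_a := (p⇛q)→(⊤⇛(p⇛q))`. -/
def paFml : Fml := .imp (.sto (.var 0) (.var 1)) (.sto .top (.sto (.var 0) (.var 1)))
/-- `4a := p⇛(⊤⇛p)`. -/
def fourAFml : Fml := .sto (.var 0) (.sto .top (.var 0))
/-- `di := ((p⇛r)∧(q⇛r))→((p∨q)⇛r)`. -/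
def diFml : Fml := .imp (.and (.sto (.var 0) (.var 2)) (.sto (.var 1) (.var 2)))
    (.sto (.or (.var 0) (.var 1)) (.var 2))

theorem FlatFrame.sat_mono {F : FlatFrame} {V : Nat → F.W → Prop} (hV : F.IsUpset V) (φ : Fml)
    {w v : F.W} (hwv : F.le w v) (h : F.sat V φ w) : F.sat V φ v := by
  induction φ with
  | var p => exact hV p hwv h
  | top => trivial
  | bot => exact h
  | and φ ψ ihφ ihψ => exact ⟨ihφ h.1, ihψ h.2⟩
  | or φ ψ ihφ ihψ => exact h.imp ihφ ihψ
  | imp φ ψ => exact fun u hvu => h u (F.le_trans hwv hvu)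
  | sto φ ψ => exact fun u hvu => h u (F.le_trans hwv hvu)

theorem IpcAx.sat {F : FlatFrame} {V : Nat → F.W → Prop} (hV : F.IsUpset V) {φ : Fml}
    (h : IpcAx φ) (w : F.W) : F.sat V φ w := by
  cases h with
  | k φ ψ => exact fun _ _ hφ _ hvu _ => F.sat_mono hV φ hvu hφ
  | s φ ψ χ =>
    exact fun v _ h u hvu h' x hux hφ =>
      h x (F.le_trans hvu hux) hφ x (F.le_refl x) (h' x hux hφ)
  | andE1 => exact fun _ _ h => h.1
  | andE2 => exact fun _ _ h => h.2
  | andI φ ψ => exact fun _ _ hφ _ hvu hψ => ⟨F.sat_mono hV φ hvu hφ, hψ⟩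
  | orI1 => exact fun _ _ h => Or.inl h
  | orI2 => exact fun _ _ h => Or.inr h
  | orE =>
    exact fun _ _ h u hvu h' x hux hor =>
      hor.elim (h x (F.le_trans hvu hux)) (h' x hux)
  | botE => exact fun _ _ h => h.elim
  | top => trivial

theorem BaseAx.sat {F : FlatFrame} {V : Nat → F.W → Prop} (hV : F.IsUpset V) {φ : Fml}
    (h : BaseAx φ) (w : F.W) : F.sat V φ w := by
  cases h with
  | ipc h => exact h.sat hV w
  | ka => exact fun _ _ h u hvu hR x hux => ⟨h.1 u hvu hR x hux, h.2 u hvu hR x hux⟩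
  | tr => exact fun _ _ h u hvu hR => h.2 u hvu (h.1 u hvu hR)

theorem FlatFrame.sat_subst_diFml {F : FlatFrame}
    (hF : ∀ ⦃w v u : F.W⦄, F.R w v → F.R w u → F.le v u ∧ F.le u v)
    {V : Nat → F.W → Prop} (hV : F.IsUpset V) (σ : Nat → Fml) (w : F.W) :
    F.sat V (diFml.subst σ) w := by
  intro v _ h u hvu hR x hux
  rcases hR x hux with hφ | hψ
  · exact h.1 u hvu (fun y huy => F.sat_mono hV _ (hF hux huy).1 hφ) x hux
  · exact h.2 u hvu (fun y huy => F.sat_mono hV _ (hF hux huy).1 hψ) x hux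

theorem Deriv.validCons_of_cluster {Γ : Set Fml} {φ : Fml} (h : Deriv {diFml} Γ φ)
    {F : FlatFrame} (hF : ∀ ⦃w v u : F.W⦄, F.R w v → F.R w u → F.le v u ∧ F.le u v) :
    F.ValidCons Γ φ := by
  intro V hV
  induction h with
  | base h => exact fun w _ => h.sat hV w
  | axm σ h =>
    rw [Set.mem_singleton_iff] at h
    subst h
    exact fun w _ => F.sat_subst_diFml hF hV σ w
  | el h => exact fun _ hΓ => hΓ _ h
  | mp _ _ ih ih' => exact fun w hΓ => ih' w hΓ w (F.le_refl w) (ih w hΓ)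
  | na _ ih =>
    exact fun _ _ u _ hR x hux => ih x (by simp) x (F.le_refl x) (hR x hux)

namespace Deriv

variable {Ax Γ Δ : Set Fml} {φ ψ χ : Fml}

theorem ipc (h : IpcAx φ) : Deriv Ax Γ φ := .base (.ipc h)

theorem mono (h : Deriv Ax Γ φ) : ∀ {Δ : Set Fml}, Γ ⊆ Δ → Deriv Ax Δ φ := by
  induction h with
  | base h => exact fun _ => .base h
  | axm σ h => exact fun _ => .axm σ h
  | el h => exact fun hs => .el (hs h)
  | mp _ _ ih ih' => exact fun hs => .mp (ih hs) (ih' hs)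
  | na h => exact fun _ => .na h

theorem imp_intro (h : Deriv Ax Γ ψ) : Deriv Ax Γ (.imp φ ψ) := .mp h (ipc (.k _ _))

/-- The deduction theorem. -/
theorem deduction (h : Deriv Ax (insert φ Γ) ψ) : Deriv Ax Γ (.imp φ ψ) := by
  generalize hΔ : insert φ Γ = Δ at h
  induction h with
  | base h => exact imp_intro (.base h)
  | axm σ h => exact imp_intro (.axm σ h)
  | el h =>
    subst hΔ
    rcases h with rfl | h
    · exact .mp (imp_intro (ψ := .top) (ipc .top))
        (.mp (ipc (.k _ .top)) (ipc (.s _ _ _)))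
    · exact imp_intro (.el h)
  | mp _ _ ih ih' => exact .mp (ih hΔ) (.mp (ih' hΔ) (ipc (.s _ _ _)))
  | na h => exact imp_intro (.na h)

theorem and_intro (h : Deriv Ax Γ φ) (h' : Deriv Ax Γ ψ) : Deriv Ax Γ (.and φ ψ) :=
  .mp h' (.mp h (ipc (.andI _ _)))

theorem and_left (h : Deriv Ax Γ (.and φ ψ)) : Deriv Ax Γ φ := .mp h (ipc (.andE1 _ _))

theorem and_right (h : Deriv Ax Γ (.and φ ψ)) : Deriv Ax Γ ψ := .mp h (ipc (.andE2 _ _))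

theorem or_elim (h : Deriv Ax Γ (.or φ ψ)) (hφ : Deriv Ax Γ (.imp φ χ))
    (hψ : Deriv Ax Γ (.imp ψ χ)) : Deriv Ax Γ χ :=
  .mp h (.mp hψ (.mp hφ (ipc (.orE _ _ _))))

theorem hyp : Deriv Ax (insert φ Γ) φ := .el (Set.mem_insert _ _)

theorem imp_trans (h : Deriv Ax Γ (.imp φ ψ)) (h' : Deriv Ax Γ (.imp ψ χ)) :
    Deriv Ax Γ (.imp φ χ) :=
  deduction (.mp (.mp hyp (h.mono (Set.subset_insert _ _))) (h'.mono (Set.subset_insert _ _)))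

theorem imp_and (h : Deriv Ax Γ (.imp φ ψ)) (h' : Deriv Ax Γ (.imp φ χ)) :
    Deriv Ax Γ (.imp φ (.and ψ χ)) :=
  deduction (and_intro (.mp hyp (h.mono (Set.subset_insert _ _)))
    (.mp hyp (h'.mono (Set.subset_insert _ _))))

theorem or_imp (h : Deriv Ax Γ (.imp φ χ)) (h' : Deriv Ax Γ (.imp ψ χ)) :
    Deriv Ax Γ (.imp (.or φ ψ) χ) :=
  deduction (or_elim hyp (h.mono (Set.subset_insert _ _)) (h'.mono (Set.subset_insert _ _)))

theorem and_or_distrib :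
    Deriv Ax Γ (.imp (.and φ (.or ψ χ)) (.or (.and φ ψ) (.and φ χ))) :=
  deduction (or_elim (and_right hyp)
    (deduction (.mp (and_intro (and_left (ψ := .or ψ χ) (.el (by simp))) hyp) (ipc (.orI1 _ _))))
    (deduction (.mp (and_intro (and_left (ψ := .or ψ χ) (.el (by simp))) hyp) (ipc (.orI2 _ _)))))

theorem imp_self : Deriv Ax Γ (.imp φ φ) := deduction hyp

end Deriv

/-- A consequence relation between single formulas which extends provable implication and
treats conjunction and disjunction as meet and join. -/
structure IsLatticeConsequence (Ax : Set Fml) (r : Fml → Fml → Prop) : Prop where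
  of_deriv : ∀ {φ ψ}, Deriv Ax ∅ (.imp φ ψ) → r φ ψ
  trans : ∀ {φ ψ χ}, r φ ψ → r ψ χ → r φ χ
  and_intro : ∀ {φ ψ χ}, r φ ψ → r φ χ → r φ (.and ψ χ)
  or_elim : ∀ {φ ψ χ}, r φ χ → r ψ χ → r (.or φ ψ) χ

/-- Nonempty sets of formulas closed under `r` and under conjunction. -/
structure IsFilterFor (r : Fml → Fml → Prop) (Δ : Set Fml) : Prop where
  nonempty : Δ.Nonempty
  closed : ∀ {φ ψ}, φ ∈ Δ → r φ ψ → ψ ∈ Δ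
  and_mem : ∀ {φ ψ}, φ ∈ Δ → ψ ∈ Δ → .and φ ψ ∈ Δ

theorem IsFilterFor.adjoin {Ax : Set Fml} {r : Fml → Fml → Prop}
    (hr : IsLatticeConsequence Ax r) {Δ : Set Fml} (hΔ : IsFilterFor r Δ) (φ : Fml) :
    IsFilterFor r {χ | ∃ δ ∈ Δ, r (.and δ φ) χ} where
  nonempty := by
    obtain ⟨δ, hδ⟩ := hΔ.nonempty
    exact ⟨δ, δ, hδ, hr.of_deriv (.ipc (.andE1 _ _))⟩
  closed := fun ⟨δ, hδ, h⟩ h' => ⟨δ, hδ, hr.trans h h'⟩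
  and_mem := by
    rintro χ χ' ⟨δ, hδ, h⟩ ⟨δ', hδ', h'⟩
    refine ⟨.and δ δ', hΔ.and_mem hδ hδ', hr.and_intro (hr.trans (hr.of_deriv ?_) h)
      (hr.trans (hr.of_deriv ?_) h')⟩
    · exact .deduction (.and_intro (.and_left (.and_left .hyp)) (.and_right .hyp))
    · exact .deduction (.and_intro (.and_right (.and_left .hyp)) (.and_right .hyp))

/-- The prime filter theorem. -/
theorem IsLatticeConsequence.exists_prime {Ax : Set Fml} {r : Fml → Fml → Prop}
    (hr : IsLatticeConsequence Ax r) {φ ψ : Fml} (h : ¬ r φ ψ) :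
    ∃ Δ : Set Fml, IsFilterFor r Δ ∧ φ ∈ Δ ∧ ψ ∉ Δ ∧
      ∀ {α β}, Fml.or α β ∈ Δ → α ∈ Δ ∨ β ∈ Δ := by
  have h₀ : IsFilterFor r {χ | r φ χ} :=
    ⟨⟨φ, hr.of_deriv .imp_self⟩, fun h h' => hr.trans h h', hr.and_intro⟩
  obtain ⟨M, hφM, hM⟩ := zorn_subset_nonempty {Δ : Set Fml | IsFilterFor r Δ ∧ ψ ∉ Δ}
    (fun c hc hchain ⟨Δ₀, hΔ₀⟩ => by
      refine ⟨⋃₀ c, ⟨⟨?_, ?_, ?_⟩, ?_⟩, fun s hs => Set.subset_sUnion_of_mem hs⟩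
      · obtain ⟨δ, hδ⟩ := (hc hΔ₀).1.nonempty
        exact ⟨δ, Δ₀, hΔ₀, hδ⟩
      · rintro α β ⟨Δ, hΔ, hα⟩ hαβ
        exact ⟨Δ, hΔ, (hc hΔ).1.closed hα hαβ⟩
      · rintro α β ⟨Δ, hΔ, hα⟩ ⟨Δ', hΔ', hβ⟩
        rcases hchain.total hΔ hΔ' with hs | hs
        · exact ⟨Δ', hΔ', (hc hΔ').1.and_mem (hs hα) hβ⟩
        · exact ⟨Δ, hΔ, (hc hΔ).1.and_mem hα (hs hβ)⟩
      · rintro ⟨Δ, hΔ, hψ⟩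
        exact (hc hΔ).2 hψ) {χ | r φ χ} ⟨h₀, h⟩
  have key : ∀ α, α ∉ M → ∃ δ ∈ M, r (.and δ α) ψ := by
    intro α hα
    by_contra hψ
    have hsub : M ⊆ {χ | ∃ δ ∈ M, r (.and δ α) χ} :=
      fun δ hδ => ⟨δ, hδ, hr.of_deriv (.ipc (.andE1 _ _))⟩
    obtain ⟨δ, hδ⟩ := hM.prop.1.nonempty
    exact hα (hM.le_of_ge ⟨hM.prop.1.adjoin hr α, hψ⟩ hsub
      ⟨δ, hδ, hr.of_deriv (.ipc (.andE2 _ _))⟩)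
  refine ⟨M, hM.prop.1, hφM (hr.of_deriv .imp_self), hM.prop.2, fun {α β} hor => ?_⟩
  by_contra! hαβ
  obtain ⟨δ, hδ, hα⟩ := key α hαβ.1
  obtain ⟨δ', hδ', hβ⟩ := key β hαβ.2
  refine hM.prop.2 (hM.prop.1.closed (hM.prop.1.and_mem (hM.prop.1.and_mem hδ hδ') hor)
    (hr.trans (hr.of_deriv .and_or_distrib) (hr.or_elim (hr.trans (hr.of_deriv ?_) hα)
      (hr.trans (hr.of_deriv ?_) hβ))))
  · exact .deduction (.and_intro (.and_left (.and_left .hyp)) (.and_right .hyp))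
  · exact .deduction (.and_intro (.and_right (.and_left .hyp)) (.and_right .hyp))

/-- Consistent sets of formulas closed under derivability, with the disjunction property. -/
structure IsPrimeTheory (Ax : Set Fml) (Δ : Set Fml) : Prop where
  mem_of_deriv : ∀ {φ}, Deriv Ax Δ φ → φ ∈ Δ
  bot_notMem : Fml.bot ∉ Δ
  or_mem : ∀ {φ ψ}, Fml.or φ ψ ∈ Δ → φ ∈ Δ ∨ ψ ∈ Δ

theorem IsFilterFor.mem_of_deriv {Ax : Set Fml} {r : Fml → Fml → Prop}
    (hr : IsLatticeConsequence Ax r) {Δ : Set Fml} (hΔ : IsFilterFor r Δ) {φ : Fml}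
    (h : Deriv Ax Δ φ) : φ ∈ Δ := by
  have of_thm : ∀ {χ}, Deriv Ax ∅ χ → χ ∈ Δ := fun h =>
    let ⟨_, hδ⟩ := hΔ.nonempty
    hΔ.closed hδ (hr.of_deriv (.imp_intro h))
  generalize hΓ : Δ = Γ at h
  induction h with
  | base h => exact hΓ ▸ of_thm (.base h)
  | axm σ h => exact hΓ ▸ of_thm (.axm σ h)
  | el h => exact h
  | mp _ _ ih ih' =>
    subst hΓ
    exact hΔ.closed (hΔ.and_mem (ih rfl) (ih' rfl))
      (hr.of_deriv (.deduction (.mp (.and_left .hyp) (.and_right .hyp))))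
  | na h => exact hΓ ▸ of_thm (.na h)

theorem IsLatticeConsequence.exists_primeTheory {Ax : Set Fml} {r : Fml → Fml → Prop}
    (hr : IsLatticeConsequence Ax r) {φ ψ : Fml} (h : ¬ r φ ψ) :
    ∃ Δ : Set Fml, IsPrimeTheory Ax Δ ∧ (∀ {α β}, α ∈ Δ → r α β → β ∈ Δ) ∧ φ ∈ Δ ∧ ψ ∉ Δ := by
  obtain ⟨Δ, hΔ, hφ, hψ, hor⟩ := hr.exists_prime h
  exact ⟨Δ, ⟨hΔ.mem_of_deriv hr, fun hbot => hψ (hΔ.closed hbot (hr.of_deriv (.ipc (.botE _)))),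
    hor⟩, hΔ.closed, hφ, hψ⟩

theorem isLatticeConsequence_imp (Ax Γ : Set Fml) :
    IsLatticeConsequence Ax fun φ ψ => Deriv Ax Γ (.imp φ ψ) where
  of_deriv h := h.mono (Set.empty_subset _)
  trans := .imp_trans
  and_intro := .imp_and
  or_elim := .or_imp

theorem isLatticeConsequence_sto (Γ : Set Fml) :
    IsLatticeConsequence {diFml} fun φ ψ => Deriv {diFml} Γ (.sto φ ψ) where
  of_deriv h := .na h
  trans h h' := .mp (.and_intro h h') (.base (.tr _ _ _))
  and_intro h h' := .mp (.and_intro h h') (.base (.ka _ _ _))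
  or_elim {φ ψ χ} h h' := .mp (.and_intro h h')
    (.axm (fun n => if n = 0 then φ else if n = 1 then ψ else χ) (Set.mem_singleton diFml))

theorem Deriv.exists_primeTheory {Ax Γ : Set Fml} {φ ψ : Fml} (h : ¬ Deriv Ax Γ (.imp φ ψ)) :
    ∃ Δ : Set Fml, IsPrimeTheory Ax Δ ∧ Γ ⊆ Δ ∧ φ ∈ Δ ∧ ψ ∉ Δ := by
  obtain ⟨Δ, hΔ, hcl, hφ, hψ⟩ := (isLatticeConsequence_imp Ax Γ).exists_primeTheory h
  exact ⟨Δ, hΔ, fun γ hγ => hcl hφ (.imp_intro (.el hγ)), hφ, hψ⟩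

/-- Worlds of the canonical model: a prime theory together with the theory of its
`R`-successors. -/
structure CanonicalWorld : Type where
  theory : Set Fml
  prime : IsPrimeTheory {diFml} theory
  succ : Set Fml
  succ_closed : ∀ {φ ψ}, .sto φ ψ ∈ theory → φ ∈ succ → ψ ∈ succ

/-- The world over a prime theory which has no `R`-successors. -/
def IsPrimeTheory.toWorld {Δ : Set Fml} (hΔ : IsPrimeTheory {diFml} Δ) : CanonicalWorld :=
  ⟨Δ, hΔ, Set.univ, fun _ _ => trivial⟩

/-- The canonical frame. -/
def canonicalFrame (h : Nonempty CanonicalWorld) : FlatFrame where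
  W := CanonicalWorld
  ne := h
  le w v := w.theory ⊆ v.theory
  le_refl _ := subset_rfl
  le_trans _ _ _ := subset_trans
  R w v := v.theory = w.succ

theorem canonicalFrame_sat_iff (h : Nonempty CanonicalWorld) (φ : Fml) (w : CanonicalWorld) :
    (canonicalFrame h).sat (fun p v => .var p ∈ v.theory) φ w ↔ φ ∈ w.theory := by
  induction φ generalizing w with
  | var p => exact Iff.rfl
  | top => exact iff_of_true trivial (w.prime.mem_of_deriv (.ipc .top))
  | bot => exact iff_of_false id w.prime.bot_notMem
  | and φ ψ ihφ ihψ =>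
    refine (and_congr (ihφ w) (ihψ w)).trans ⟨fun h => ?_, fun h => ⟨?_, ?_⟩⟩
    · exact w.prime.mem_of_deriv (.and_intro (.el h.1) (.el h.2))
    · exact w.prime.mem_of_deriv (.and_left (.el h))
    · exact w.prime.mem_of_deriv (.and_right (.el h))
  | or φ ψ ihφ ihψ =>
    refine (or_congr (ihφ w) (ihψ w)).trans ⟨fun h => ?_, w.prime.or_mem⟩
    rcases h with h | h
    · exact w.prime.mem_of_deriv (.mp (.el h) (.ipc (.orI1 _ _)))
    · exact w.prime.mem_of_deriv (.mp (.el h) (.ipc (.orI2 _ _)))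
  | imp φ ψ ihφ ihψ =>
    constructor
    · intro hw
      by_contra hnot
      obtain ⟨Δ, hΔ, hwΔ, hφ, hψ⟩ :=
        Deriv.exists_primeTheory fun hd => hnot (w.prime.mem_of_deriv hd)
      exact hψ ((ihψ hΔ.toWorld).1 (hw hΔ.toWorld hwΔ ((ihφ hΔ.toWorld).2 hφ)))
    · intro hw v hwv hφ
      exact (ihψ v).2 (v.prime.mem_of_deriv (.mp (.el ((ihφ v).1 hφ)) (.el (hwv hw))))
  | sto φ ψ ihφ ihψ =>
    constructor
    · intro hw
      by_contra hnot
      obtain ⟨Δ, hΔ, hcl, hφ, hψ⟩ := (isLatticeConsequence_sto w.theory).exists_primeTheory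
        fun hd => hnot (w.prime.mem_of_deriv hd)
      refine hψ ((ihψ hΔ.toWorld).1 (hw ⟨w.theory, w.prime, Δ, fun hs hα => hcl hα (.el hs)⟩
        (subset_refl w.theory) (fun v hv => (ihφ v).2 ?_) hΔ.toWorld rfl))
      exact (show v.theory = Δ from hv) ▸ hφ
    · intro hw w' hww' hR v hv
      have hv' : v.theory = w'.succ := hv
      refine (ihψ v).2 (hv' ▸ w'.succ_closed (hww' hw) (hv' ▸ (ihφ v).1 (hR v hv)))

/-- `HLC♯ = HLC♭ ⊕ di` is sound and complete with respect to the
class of flat frames in which `R[w]` is a cluster for every `w`. -/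
theorem hlc_sharp_sound_complete_clusters (Γ : Set Fml) (φ : Fml) :
    Deriv {diFml} Γ φ ↔
      ∀ F : FlatFrame,
        (∀ ⦃w v u : F.W⦄, F.R w v → F.R w u → F.le v u ∧ F.le u v) →
        F.ValidCons Γ φ := by
  refine ⟨fun h F hF => h.validCons_of_cluster hF, fun h => ?_⟩
  by_contra hnot
  obtain ⟨Δ, hΔ, hΓΔ, -, hφ⟩ := Deriv.exists_primeTheory (φ := .top)
    fun hd => hnot (.mp (.ipc .top) hd)
  have hne : Nonempty CanonicalWorld := ⟨hΔ.toWorld⟩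
  refine hφ ((canonicalFrame_sat_iff hne φ hΔ.toWorld).1 (h (canonicalFrame hne) ?_ _ ?_ _ ?_))
  · intro w v u hv hu
    have hvu : v.theory = u.theory := Eq.trans hv (Eq.symm hu)
    exact ⟨hvu.subset, hvu.symm.subset⟩
  · exact fun p w v hwv hp => hwv hp
  · exact fun ψ hψ => (canonicalFrame_sat_iff hne ψ hΔ.toWorld).2 (hΓΔ hψ)
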